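/- Let M be a finite measure space, σ ≥ 3/2, and let Φ : L^{2σ}(M;ℂ) → ℝ be defined by Φ(u) = ∫_M |u(x)|^{2σ} dx. Then Φ is twice (real) Fréchet differentiable with Φ'(u)(v) = ∫_M 2σ |u(x)|^{2(σ-1)} Re(u(x)·conj(v(x))) dx for u, v in the domain. -/

import Mathlib

open MeasureTheory
open scoped ENNReal

noncomputable def gF (p : ℝ) (z : ℂ) : ℂ := (p * ‖z‖ ^ (p - 2)) • z

noncomputable def HF (p : ℝ) (z h : ℂ) : ℂ :=
  (p * ‖z‖ ^ (p - 2)) • (h + ((p - 2) * ((z / (‖z‖ : ℂ)) * (starRingEnd ℂ) h).re) • (z / (‖z‖ : ℂ)))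

lemma taylor_two {E F : Type*} [NormedAddCommGroup E] [NormedSpace ℝ E] [NormedAddCommGroup F]
    [NormedSpace ℝ F] {f : E → F} {x : E} (hf : ContDiffAt ℝ 2 f x) :
    ∃ C δ : ℝ, 0 ≤ C ∧ 0 < δ ∧ ∀ k : E, ‖k‖ < δ →
      ‖f (x + k) - f x - fderiv ℝ f x k‖ ≤ C * ‖k‖ ^ 2 := by
  have h1 : ContDiffAt ℝ 1 (fderiv ℝ f) x := hf.fderiv_right (by norm_num)
  obtain ⟨K, t, ht, hK⟩ := h1.exists_lipschitzOnWith
  have h2 : ∀ᶠ y in nhds x, DifferentiableAt ℝ f y := by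
    have := hf.eventually (by simp)
    filter_upwards [this] with y hy
    exact hy.differentiableAt (by norm_num)
  obtain ⟨δ, hδ, hsub⟩ := Metric.mem_nhds_iff.mp (Filter.inter_mem ht h2)
  refine ⟨K, δ, K.2, hδ, fun k hk => ?_⟩
  have hx : x ∈ t := (hsub (Metric.mem_ball_self hδ)).1
  have hss : Metric.closedBall x ‖k‖ ⊆ Metric.ball x δ := Metric.closedBall_subset_ball hk
  have := (convex_closedBall x ‖k‖).norm_image_sub_le_of_norm_fderiv_le' (𝕜 := ℝ) (f := f)
    (φ := fderiv ℝ f x) (C := K * ‖k‖) (x := x) (y := x + k)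
    (fun y hy => (hsub (hss hy)).2) (fun y hy => by
      have := hK.norm_sub_le (hsub (hss hy)).1 hx
      refine this.trans ?_
      gcongr
      simpa [dist_eq_norm] using hy) (by simp) (by simp [dist_eq_norm])
  simpa [pow_two, mul_assoc] using this

lemma norm_unit_le (z : ℂ) : ‖z / (‖z‖ : ℂ)‖ ≤ 1 := by
  by_cases h : z = 0
  · simp [h]
  · have : ‖z‖ ≠ 0 := by simpa using h
    simp [this]

lemma norm_gF {p : ℝ} (hp : 3 ≤ p) (z : ℂ) : ‖gF p z‖ = p * (‖z‖ ^ (p - 2) * ‖z‖) := by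
  have : 0 ≤ p * ‖z‖ ^ (p - 2) := by positivity
  rw [gF, norm_smul, Real.norm_of_nonneg this, mul_assoc]

lemma norm_HF {p : ℝ} (hp : 3 ≤ p) (z h : ℂ) :
    ‖HF p z h‖ ≤ p * (p - 1) * (‖z‖ ^ (p - 2) * ‖h‖) := by
  have h0 : 0 ≤ p * ‖z‖ ^ (p - 2) := by positivity
  have he := norm_unit_le z
  rw [HF, norm_smul, Real.norm_of_nonneg h0]
  set e := z / (‖z‖ : ℂ)
  have h1 : |(e * (starRingEnd ℂ) h).re| ≤ ‖h‖ := by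
    refine (Complex.abs_re_le_norm _).trans ?_
    rw [norm_mul, RCLike.norm_conj]
    exact mul_le_of_le_one_left (norm_nonneg _) he
  have h2 : ‖((p - 2) * (e * (starRingEnd ℂ) h).re) • e‖ ≤ (p - 2) * ‖h‖ := by
    rw [norm_smul, norm_mul, Real.norm_of_nonneg (by linarith : 0 ≤ p - 2), Real.norm_eq_abs]
    have : (p - 2) * |(e * (starRingEnd ℂ) h).re| ≤ (p - 2) * ‖h‖ :=
      mul_le_mul_of_nonneg_left h1 (by linarith)
    exact (mul_le_of_le_one_right (mul_nonneg (by linarith) (abs_nonneg _)) he).trans this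
  have h3 := (norm_add_le h (((p - 2) * (e * (starRingEnd ℂ) h).re) • e)).trans
    (add_le_add_right h2 _)
  calc _ ≤ (p * ‖z‖ ^ (p - 2)) * (‖h‖ + (p - 2) * ‖h‖) := mul_le_mul_of_nonneg_left h3 h0
    _ = _ := by ring

lemma taylor_gF_one {p : ℝ} : ∃ C δ : ℝ, 0 ≤ C ∧ 0 < δ ∧ ∀ k : ℂ, ‖k‖ < δ →
      ‖gF p (1 + k) - gF p 1 - HF p 1 k‖ ≤ C * ‖k‖ ^ 2 := by
  have hc : ContDiffAt ℝ 2 (gF p) (1 : ℂ) := by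
    unfold gF
    have : ContDiffAt ℝ 2 (fun z : ℂ => ‖z‖) (1 : ℂ) := contDiffAt_norm ℝ one_ne_zero
    exact (contDiffAt_const.mul (this.rpow_const_of_ne (by simp))).smul contDiffAt_id
  have hd : ∀ k, fderiv ℝ (gF p) 1 k = HF p 1 k := by
    intro k
    have h1 := (hasStrictFDerivAt_norm_sq (1 : ℂ)).hasFDerivAt.rpow_const (p := (p - 2) / 2)
      (Or.inl (by simp))
    have h2 := (h1.const_mul p).smul (hasFDerivAt_id (𝕜 := ℝ) (1 : ℂ))
    have h3 : (fun z : ℂ => p * (‖z‖ ^ 2) ^ ((p - 2) / 2)) • (id : ℂ → ℂ) = gF p := by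
      funext z
      simp only [Pi.smul_apply', gF, id]
      rw [← Real.rpow_natCast_mul (norm_nonneg _)]
      congr 3
      push_cast; ring
    rw [h3] at h2
    rw [h2.fderiv]
    simp [HF, Complex.ext_iff]
    ring_nf
    simp
  obtain ⟨C, δ, hC, hδ, h⟩ := taylor_two hc
  exact ⟨C, δ, hC, hδ, fun k hk => by rw [← hd]; exact h k hk⟩

lemma bound_gF_one {p : ℝ} (hp : 3 ≤ p) : ∃ C : ℝ, 0 ≤ C ∧ ∀ k : ℂ,
      ‖gF p (1 + k) - gF p 1 - HF p 1 k‖ ≤ C * ((1 + ‖k‖) ^ (p - 3) * ‖k‖ ^ 2) := by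
  obtain ⟨C, δ, hC, hδ, h⟩ := taylor_gF_one (p := p)
  set D := (p + p + p * (p - 1)) * (1 + 1 / δ) ^ 2 with hD
  have hD0 : 0 ≤ D := by
    have : 0 ≤ p - 1 := by linarith
    positivity
  refine ⟨C + D, by positivity, fun k => ?_⟩
  have hA : 1 ≤ 1 + ‖k‖ := by linarith [norm_nonneg k]
  have hA1 : 1 ≤ (1 + ‖k‖) ^ (p - 3) := Real.one_le_rpow hA (by linarith)
  by_cases hk : ‖k‖ < δ
  · refine (h k hk).trans ?_
    have : ‖k‖ ^ 2 ≤ (1 + ‖k‖) ^ (p - 3) * ‖k‖ ^ 2 := le_mul_of_one_le_left (by positivity) hA1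
    exact (mul_le_mul_of_nonneg_left this hC).trans
      (mul_le_mul_of_nonneg_right (by linarith) (by positivity))
  · push Not at hk
    set A := 1 + ‖k‖
    have hA2 : A ≤ (1 + 1 / δ) * ‖k‖ := by
      have : 1 ≤ 1 / δ * ‖k‖ := by
        rw [one_div, inv_mul_eq_div, le_div_iff₀ hδ]; linarith
      simp only [A]; linarith
    have hn : ‖1 + k‖ ≤ A := by simpa using norm_add_le (1 : ℂ) k
    have hpw : A ^ (p - 2) * A = A ^ (p - 3) * A ^ 2 := by
      rw [show p - 2 = (p - 3) + 1 by ring, Real.rpow_add (by linarith), Real.rpow_one]; ring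
    have hA3 : A ≤ A ^ (p - 2) * A :=
      le_mul_of_one_le_left (by linarith) (Real.one_le_rpow hA (by linarith))
    have e1 : ‖gF p (1 + k)‖ ≤ p * (A ^ (p - 2) * A) := by
      rw [norm_gF hp]
      have : ‖1 + k‖ ^ (p - 2) ≤ A ^ (p - 2) :=
        Real.rpow_le_rpow (norm_nonneg _) hn (by linarith)
      gcongr
    have e2 : ‖gF p 1‖ ≤ p * (A ^ (p - 2) * A) := by
      rw [norm_gF hp]; simp
      exact le_mul_of_one_le_right (by linarith) (by linarith)
    have e3 : ‖HF p 1 k‖ ≤ p * (p - 1) * (A ^ (p - 2) * A) := by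
      refine (norm_HF hp 1 k).trans ?_
      have : 0 ≤ p * (p - 1) := mul_nonneg (by linarith) (by linarith)
      refine mul_le_mul_of_nonneg_left ?_ this
      simp
      have : ‖k‖ ≤ A := by simp [A]
      linarith
    calc _ ≤ ‖gF p (1 + k)‖ + ‖gF p 1‖ + ‖HF p 1 k‖ :=
          (norm_sub_le _ _).trans (add_le_add_left (norm_sub_le _ _) _)
      _ ≤ (p + p + p * (p - 1)) * (A ^ (p - 2) * A) := by linarith
      _ = (p + p + p * (p - 1)) * (A ^ (p - 3) * A ^ 2) := by rw [hpw]
      _ ≤ (p + p + p * (p - 1)) * (A ^ (p - 3) * ((1 + 1 / δ) * ‖k‖) ^ 2) := by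
          have : 0 ≤ p + p + p * (p - 1) := by nlinarith
          gcongr
      _ = D * (A ^ (p - 3) * ‖k‖ ^ 2) := by rw [hD]; ring
      _ ≤ _ := mul_le_mul_of_nonneg_right (by linarith) (by positivity)

lemma bound_gF {p : ℝ} (hp : 3 ≤ p) : ∃ C : ℝ, 0 ≤ C ∧ ∀ z h : ℂ,
      ‖gF p (z + h) - gF p z - HF p z h‖ ≤ C * ((‖z‖ + ‖h‖) ^ (p - 3) * ‖h‖ ^ 2) := by
  obtain ⟨C, hC, hb⟩ := bound_gF_one hp
  refine ⟨C + p, by linarith, fun z h => ?_⟩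
  by_cases hz : z = 0
  · subst hz
    have e : gF p (0 + h) - gF p 0 - HF p 0 h = gF p h := by
      simp [gF, HF, Real.zero_rpow (by linarith : p - 2 ≠ 0)]
    rw [e, norm_gF hp, norm_zero, zero_add]
    have : ‖h‖ ^ (p - 2) * ‖h‖ = ‖h‖ ^ (p - 3) * ‖h‖ ^ 2 := by
      rw [show p - 2 = (p - 3) + 1 by ring,
        Real.rpow_add_of_nonneg (norm_nonneg _) (by linarith) (by norm_num), Real.rpow_one]
      ring
    rw [this]
    exact mul_le_mul_of_nonneg_right (by linarith) (by positivity)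
  · have hz0 : 0 < ‖z‖ := norm_pos_iff.mpr hz
    have hzc : (‖z‖ : ℂ) ≠ 0 := by exact_mod_cast hz0.ne'
    set k := h / z with hk
    have hh : h = z * k := by rw [hk]; field_simp
    have hzk : z + h = z * (1 + k) := by rw [hh]; ring
    have hm : ∀ w, gF p (z * w) = (‖z‖ ^ (p - 2)) • (z * gF p w) := by
      intro w
      simp only [gF, norm_mul, Real.mul_rpow (norm_nonneg z) (norm_nonneg w), Complex.real_smul]
      push_cast; ring
    have hH : HF p z h = (‖z‖ ^ (p - 2)) • (z * HF p 1 k) := by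
      have e1 : (z / (‖z‖ : ℂ)) * (starRingEnd ℂ) h = (‖z‖ : ℂ) * (starRingEnd ℂ) k := by
        rw [hh, map_mul]
        have := Complex.mul_conj z
        rw [Complex.normSq_eq_norm_sq] at this
        push_cast at this
        field_simp
        linear_combination ((starRingEnd ℂ) k) * this
      have e2 : (z / (‖z‖ : ℂ) * (starRingEnd ℂ) h).re = ‖z‖ * k.re := by
        rw [e1]; simp
      simp only [HF, e2]
      rw [hh]
      simp only [Complex.real_smul, norm_one, Real.one_rpow, Complex.ofReal_one, div_one, one_mul,
        Complex.conj_re]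
      push_cast
      field_simp
    have e : gF p (z + h) - gF p z - HF p z h
        = (‖z‖ ^ (p - 2)) • (z * (gF p (1 + k) - gF p 1 - HF p 1 k)) := by
      have := hm 1
      rw [mul_one] at this
      rw [hzk, hm, this, hH, mul_sub, mul_sub, smul_sub, smul_sub]
    have hn : ‖h‖ = ‖z‖ * ‖k‖ := by rw [hh, norm_mul]
    rw [e, norm_smul, norm_mul, Real.norm_of_nonneg (by positivity)]
    have e3 : (‖z‖ + ‖h‖) ^ (p - 3) = ‖z‖ ^ (p - 3) * (1 + ‖k‖) ^ (p - 3) := by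
      rw [← Real.mul_rpow (norm_nonneg _) (by positivity), hn]; ring_nf
    have e4 : ‖z‖ ^ (p - 2) = ‖z‖ ^ (p - 3) * ‖z‖ := by
      rw [show p - 2 = (p - 3) + 1 by ring, Real.rpow_add hz0, Real.rpow_one]
    calc _ ≤ ‖z‖ ^ (p - 2) * (‖z‖ * (C * ((1 + ‖k‖) ^ (p - 3) * ‖k‖ ^ 2))) := by
            gcongr; exact hb k
      _ = C * ((‖z‖ + ‖h‖) ^ (p - 3) * ‖h‖ ^ 2) := by rw [e3, e4, hn]; ring
      _ ≤ _ := mul_le_mul_of_nonneg_right (by linarith) (by positivity)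

lemma bound_f {p : ℝ} (hp : 3 ≤ p) : ∃ C : ℝ, 0 ≤ C ∧ ∀ z h : ℂ,
      |‖z + h‖ ^ p - ‖z‖ ^ p - (gF p z * (starRingEnd ℂ) h).re|
        ≤ C * ((‖z‖ + ‖h‖) ^ (p - 2) * ‖h‖ ^ 2) := by
  obtain ⟨C, hC, hb⟩ := bound_gF hp
  have hp1 : 0 ≤ p * (p - 1) := mul_nonneg (by linarith) (by linarith)
  refine ⟨C + p * (p - 1), by linarith, fun z h => ?_⟩
  have hlip : ∀ y ∈ Metric.closedBall z ‖h‖, ‖gF p y - gF p z‖ ≤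
      (C + p * (p - 1)) * ((‖z‖ + ‖h‖) ^ (p - 2) * ‖h‖) := by
    intro y hy
    have hy' : ‖y - z‖ ≤ ‖h‖ := by simpa [dist_eq_norm] using hy
    have b1 := hb z (y - z)
    have b2 := norm_HF hp z (y - z)
    rw [add_sub_cancel] at b1
    have b3 : ‖gF p y - gF p z‖ ≤ ‖gF p y - gF p z - HF p z (y - z)‖ + ‖HF p z (y - z)‖ := by
      simpa using norm_add_le (gF p y - gF p z - HF p z (y - z)) (HF p z (y - z))
    have b4 : (‖z‖ + ‖y - z‖) ^ (p - 3) * ‖y - z‖ ^ 2 ≤ (‖z‖ + ‖h‖) ^ (p - 2) * ‖h‖ := by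
      have c1 : (‖z‖ + ‖y - z‖) ^ (p - 3) ≤ (‖z‖ + ‖h‖) ^ (p - 3) :=
        Real.rpow_le_rpow (by positivity) (by linarith) (by linarith)
      have c2 : (‖z‖ + ‖h‖) ^ (p - 2) = (‖z‖ + ‖h‖) ^ (p - 3) * (‖z‖ + ‖h‖) := by
        rw [show p - 2 = (p - 3) + 1 by ring,
          Real.rpow_add_of_nonneg (by positivity) (by linarith) (by norm_num), Real.rpow_one]
      rw [c2, pow_two, mul_assoc]
      have c3 : ‖y - z‖ ≤ ‖z‖ + ‖h‖ := by linarith [norm_nonneg z]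
      gcongr
    have b5 : ‖z‖ ^ (p - 2) * ‖y - z‖ ≤ (‖z‖ + ‖h‖) ^ (p - 2) * ‖h‖ := by
      have c1 : ‖z‖ ^ (p - 2) ≤ (‖z‖ + ‖h‖) ^ (p - 2) :=
        Real.rpow_le_rpow (by positivity) (by linarith [norm_nonneg h]) (by linarith)
      gcongr
    have := mul_le_mul_of_nonneg_left b4 hC
    have := mul_le_mul_of_nonneg_left b5 hp1
    linarith
  have key := (convex_closedBall z ‖h‖).norm_image_sub_le_of_norm_hasFDerivWithin_le' (𝕜 := ℝ)
    (f := fun z : ℂ => ‖z‖ ^ p) (f' := fun y => innerSL ℝ (gF p y))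
    (φ := innerSL ℝ (gF p z)) (x := z) (y := z + h)
    (C := (C + p * (p - 1)) * ((‖z‖ + ‖h‖) ^ (p - 2) * ‖h‖))
    (fun y hy => by
      have := (hasFDerivAt_norm_rpow y (by linarith : 1 < p)).hasFDerivWithinAt
        (s := Metric.closedBall z ‖h‖)
      rwa [← map_smul] at this)
    (fun y hy => by
      rw [← map_sub, innerSL_apply_norm]
      exact hlip y hy) (by simp) (by simp [dist_eq_norm])
  have e : (gF p z * (starRingEnd ℂ) h).re = innerSL ℝ (gF p z) h := by
    rw [innerSL_apply_apply, Complex.inner]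
    simp; ring
  rw [add_sub_cancel_left] at key
  rw [e, ← Real.norm_eq_abs]
  refine key.trans (le_of_eq ?_)
  ring

lemma holder3 {M : Type*} [MeasurableSpace M] {μ : Measure M} {E₁ E₂ E₃ : Type*}
    [NormedAddCommGroup E₁] [NormedAddCommGroup E₂] [NormedAddCommGroup E₃]
    {p α β γ : ℝ} (hp : 0 < p) (hα : 0 ≤ α) (hβ : 0 ≤ β) (hγ : 0 ≤ γ) (hs : α + β + γ = p)
    {a : M → E₁} {b : M → E₂} {c : M → E₃}
    (ha : MemLp a (ENNReal.ofReal p) μ) (hb : MemLp b (ENNReal.ofReal p) μ)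
    (hc : MemLp c (ENNReal.ofReal p) μ) :
    Integrable (fun x => ‖a x‖ ^ α * ‖b x‖ ^ β * ‖c x‖ ^ γ) μ ∧
    ∫ x, ‖a x‖ ^ α * ‖b x‖ ^ β * ‖c x‖ ^ γ ∂μ ≤
      (eLpNorm a (ENNReal.ofReal p) μ).toReal ^ α * (eLpNorm b (ENNReal.ofReal p) μ).toReal ^ β
        * (eLpNorm c (ENNReal.ofReal p) μ).toReal ^ γ := by
  have hP0 : ENNReal.ofReal p ≠ 0 := by simpa using hp
  have hPt : ENNReal.ofReal p ≠ ∞ := ENNReal.ofReal_ne_top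
  have hPr : (ENNReal.ofReal p).toReal = p := ENNReal.toReal_ofReal hp.le
  have hN : ∀ (I : ℝ≥0∞) (δ : ℝ), I ^ (δ / p) = (I ^ (1 / p)) ^ δ := by
    intro I δ
    rw [← ENNReal.rpow_mul]; congr 1; ring
  have key : ∫⁻ x, ‖a x‖ₑ ^ α * ‖b x‖ₑ ^ β * ‖c x‖ₑ ^ γ ∂μ ≤
      (eLpNorm a (ENNReal.ofReal p) μ) ^ α * (eLpNorm b (ENNReal.ofReal p) μ) ^ β
        * (eLpNorm c (ENNReal.ofReal p) μ) ^ γ := by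
    have := ENNReal.lintegral_prod_norm_pow_le (μ := μ) (Finset.univ : Finset (Fin 3))
      (f := ![fun x => ‖a x‖ₑ ^ p, fun x => ‖b x‖ₑ ^ p, fun x => ‖c x‖ₑ ^ p])
      (p := ![α / p, β / p, γ / p])
      (by
        intro i _
        fin_cases i
        · exact ha.1.enorm.pow_const p
        · exact hb.1.enorm.pow_const p
        · exact hc.1.enorm.pow_const p)
      (by
        simp [Fin.sum_univ_three]
        rw [← add_div, ← add_div, hs, div_self hp.ne'])
      (by
        intro i _
        fin_cases i <;> simp <;> positivity)
    simp only [Fin.prod_univ_three, Matrix.cons_val_zero, Matrix.cons_val_one, Matrix.cons_val,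
      ← ENNReal.rpow_mul, mul_div_cancel₀ _ hp.ne'] at this
    simp only [eLpNorm_eq_lintegral_rpow_enorm_toReal hP0 hPt, hPr]
    rw [hN _ α, hN _ β, hN _ γ] at this
    exact this
  have hfin : (eLpNorm a (ENNReal.ofReal p) μ) ^ α * (eLpNorm b (ENNReal.ofReal p) μ) ^ β
        * (eLpNorm c (ENNReal.ofReal p) μ) ^ γ < ∞ :=
    ENNReal.mul_lt_top (ENNReal.mul_lt_top (ENNReal.rpow_lt_top_of_nonneg hα ha.2.ne)
      (ENNReal.rpow_lt_top_of_nonneg hβ hb.2.ne)) (ENNReal.rpow_lt_top_of_nonneg hγ hc.2.ne)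
  have hm : AEStronglyMeasurable (fun x => ‖a x‖ ^ α * ‖b x‖ ^ β * ‖c x‖ ^ γ) μ :=
    (((ha.1.norm.aemeasurable.pow_const α).mul (hb.1.norm.aemeasurable.pow_const β)).mul
      (hc.1.norm.aemeasurable.pow_const γ)).aestronglyMeasurable
  have hof : ∀ x, ENNReal.ofReal (‖a x‖ ^ α * ‖b x‖ ^ β * ‖c x‖ ^ γ)
      = ‖a x‖ₑ ^ α * ‖b x‖ₑ ^ β * ‖c x‖ₑ ^ γ := by
    intro x
    rw [ENNReal.ofReal_mul (by positivity), ENNReal.ofReal_mul (by positivity),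
      ← ENNReal.ofReal_rpow_of_nonneg (norm_nonneg _) hα,
      ← ENNReal.ofReal_rpow_of_nonneg (norm_nonneg _) hβ,
      ← ENNReal.ofReal_rpow_of_nonneg (norm_nonneg _) hγ, ofReal_norm, ofReal_norm, ofReal_norm]
  have hnn : ∀ x, 0 ≤ ‖a x‖ ^ α * ‖b x‖ ^ β * ‖c x‖ ^ γ := fun x => by positivity
  refine ⟨⟨hm, ?_⟩, ?_⟩
  · rw [hasFiniteIntegral_iff_ofReal (Filter.Eventually.of_forall hnn)]
    simp only [hof]
    exact key.trans_lt hfin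
  · rw [integral_eq_lintegral_of_nonneg_ae (Filter.Eventually.of_forall hnn) hm]
    simp only [hof]
    refine (ENNReal.toReal_mono hfin.ne key).trans ?_
    simp [ENNReal.toReal_mul, ENNReal.toReal_rpow]

lemma hasFDerivAt_of_quad {E F : Type*} [NormedAddCommGroup E] [NormedSpace ℝ E]
    [NormedAddCommGroup F] [NormedSpace ℝ F] {f : E → F} {f' : E →L[ℝ] F} {u : E} {C r : ℝ}
    (hC : 0 ≤ C) (hr : 0 ≤ r)
    (h : ∀ h, ‖f (u + h) - f u - f' h‖ ≤ C * ((‖u‖ + ‖h‖) ^ r * ‖h‖ ^ 2)) :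
    HasFDerivAt f f' u := by
  rw [hasFDerivAt_iff_isLittleO_nhds_zero]
  have h1 : (fun h : E => f (u + h) - f u - f' h) =O[nhds 0] (fun h : E => ‖h‖ ^ 2) := by
    refine Asymptotics.IsBigO.of_bound (C * (‖u‖ + 1) ^ r) ?_
    filter_upwards [Metric.ball_mem_nhds (0 : E) one_pos] with k hk
    have hk' : ‖k‖ ≤ 1 := by
      have : ‖k‖ < 1 := by simpa using hk
      exact this.le
    refine (h k).trans ?_
    have : (‖u‖ + ‖k‖) ^ r ≤ (‖u‖ + 1) ^ r :=
      Real.rpow_le_rpow (by positivity) (by linarith) hr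
    rw [Real.norm_of_nonneg (by positivity), mul_assoc]
    gcongr
  exact h1.trans_isLittleO (Asymptotics.isLittleO_norm_pow_id one_lt_two)

lemma HF_add (p : ℝ) (z h k : ℂ) : HF p z (h + k) = HF p z h + HF p z k := by
  simp only [HF, map_add, mul_add, Complex.add_re, add_smul, smul_add]
  abel

lemma HF_smul (p : ℝ) (z : ℂ) (c : ℝ) (h : ℂ) : HF p z (c • h) = c • HF p z h := by
  have : (z / (‖z‖ : ℂ) * (starRingEnd ℂ) (c • h)).re
      = c * (z / (‖z‖ : ℂ) * (starRingEnd ℂ) h).re := by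
    simp only [Complex.real_smul, map_mul, Complex.conj_ofReal]
    rw [mul_left_comm, Complex.re_ofReal_mul]
  unfold HF
  rw [this]
  simp only [Complex.real_smul]
  push_cast
  ring

lemma abs_re_mul_conj_le (z w : ℂ) : |(z * (starRingEnd ℂ) w).re| ≤ ‖z‖ * ‖w‖ := by
  refine (Complex.abs_re_le_norm _).trans ?_
  rw [norm_mul, RCLike.norm_conj]

lemma integral_sub_sub {M : Type*} [MeasurableSpace M] {μ : Measure M} {f g h : M → ℝ}
    (hf : Integrable f μ) (hg : Integrable g μ) (hh : Integrable h μ) :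
    ∫ x, f x ∂μ - ∫ x, g x ∂μ - ∫ x, h x ∂μ = ∫ x, (f x - g x - h x) ∂μ := by
  have h1 : Integrable (fun x => f x - g x) μ := hf.sub hg
  rw [integral_sub h1 hh, integral_sub hf hg]

section LpPart

variable {M : Type*} [MeasurableSpace M] {μ : Measure M} {p : ℝ}

lemma intBound1 (hp : 3 ≤ p) (u h v : Lp ℂ (ENNReal.ofReal p) μ) :
    Integrable (fun x => ‖u x‖ ^ (p - 2) * ‖h x‖ * ‖v x‖) μ ∧
    ∫ x, ‖u x‖ ^ (p - 2) * ‖h x‖ * ‖v x‖ ∂μ ≤ ‖u‖ ^ (p - 2) * ‖h‖ * ‖v‖ := by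
  have := holder3 (μ := μ) (p := p) (α := p - 2) (β := 1) (γ := 1) (by linarith) (by linarith)
    one_pos.le one_pos.le (by ring) (Lp.memLp u) (Lp.memLp h) (Lp.memLp v)
  simpa only [Real.rpow_one, ← Lp.norm_def] using this

lemma sum_memLp [Fact (1 ≤ ENNReal.ofReal p)] (u h : Lp ℂ (ENNReal.ofReal p) μ) :
    MemLp (fun x => ‖u x‖ + ‖h x‖) (ENNReal.ofReal p) μ ∧
    (eLpNorm (fun x => ‖u x‖ + ‖h x‖) (ENNReal.ofReal p) μ).toReal ≤ ‖u‖ + ‖h‖ := by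
  have h1 := (Lp.memLp u).norm
  have h2 := (Lp.memLp h).norm
  refine ⟨h1.add h2, ?_⟩
  have := eLpNorm_add_le h1.1 h2.1 (Fact.out : 1 ≤ ENNReal.ofReal p)
  have h3 := ENNReal.toReal_mono (ENNReal.add_ne_top.2 ⟨h1.2.ne, h2.2.ne⟩) this
  rw [ENNReal.toReal_add h1.2.ne h2.2.ne, eLpNorm_norm, eLpNorm_norm] at h3
  rw [Lp.norm_def, Lp.norm_def]
  exact h3

lemma intBound2 (hp : 3 ≤ p) [Fact (1 ≤ ENNReal.ofReal p)] (u h v : Lp ℂ (ENNReal.ofReal p) μ) :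
    Integrable (fun x => (‖u x‖ + ‖h x‖) ^ (p - 3) * ‖h x‖ ^ 2 * ‖v x‖) μ ∧
    ∫ x, (‖u x‖ + ‖h x‖) ^ (p - 3) * ‖h x‖ ^ 2 * ‖v x‖ ∂μ ≤
      (‖u‖ + ‖h‖) ^ (p - 3) * ‖h‖ ^ 2 * ‖v‖ := by
  obtain ⟨hm, hle⟩ := sum_memLp u h
  have := holder3 (μ := μ) (p := p) (α := p - 3) (β := 2) (γ := 1) (by linarith) (by linarith)
    two_pos.le one_pos.le (by ring) hm (Lp.memLp h) (Lp.memLp v)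
  have e : ∀ x, ‖‖u x‖ + ‖h x‖‖ = ‖u x‖ + ‖h x‖ := fun x => Real.norm_of_nonneg (by positivity)
  simp only [Real.rpow_one, Real.rpow_two, ← Lp.norm_def, e] at this
  refine ⟨this.1, this.2.trans ?_⟩
  have := Real.rpow_le_rpow ENNReal.toReal_nonneg hle (by linarith : 0 ≤ p - 3)
  gcongr

lemma intBound3 (hp : 3 ≤ p) [Fact (1 ≤ ENNReal.ofReal p)] (u h : Lp ℂ (ENNReal.ofReal p) μ) :
    Integrable (fun x => (‖u x‖ + ‖h x‖) ^ (p - 2) * ‖h x‖ ^ 2) μ ∧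
    ∫ x, (‖u x‖ + ‖h x‖) ^ (p - 2) * ‖h x‖ ^ 2 ∂μ ≤
      (‖u‖ + ‖h‖) ^ (p - 2) * ‖h‖ ^ 2 := by
  obtain ⟨hm, hle⟩ := sum_memLp u h
  have := holder3 (μ := μ) (p := p) (α := p - 2) (β := 2) (γ := 0) (by linarith) (by linarith)
    two_pos.le le_rfl (by ring) hm (Lp.memLp h) (Lp.memLp h)
  have e : ∀ x, ‖‖u x‖ + ‖h x‖‖ = ‖u x‖ + ‖h x‖ := fun x => Real.norm_of_nonneg (by positivity)
  simp only [Real.rpow_zero, mul_one, Real.rpow_two, ← Lp.norm_def, e] at this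
  refine ⟨this.1, this.2.trans ?_⟩
  have := Real.rpow_le_rpow ENNReal.toReal_nonneg hle (by linarith : 0 ≤ p - 2)
  gcongr

lemma intBound0 (hp : 3 ≤ p) (u : Lp ℂ (ENNReal.ofReal p) μ) : Integrable (fun x => ‖u x‖ ^ p) μ := by
  have := (holder3 (μ := μ) (p := p) (α := p) (β := 0) (γ := 0) (by linarith) (by linarith)
    le_rfl le_rfl (by ring) (Lp.memLp u) (Lp.memLp u) (Lp.memLp u)).1
  simpa using this

lemma intG (hp : 3 ≤ p) (u v : Lp ℂ (ENNReal.ofReal p) μ) :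
    Integrable (fun x => (gF p (u x) * (starRingEnd ℂ) (v x)).re) μ ∧
    |∫ x, (gF p (u x) * (starRingEnd ℂ) (v x)).re ∂μ| ≤ p * (‖u‖ ^ (p - 2) * ‖u‖) * ‖v‖ := by
  have hmeas : Measurable (fun q : ℂ × ℂ => (gF p q.1 * (starRingEnd ℂ) q.2).re) := by
    unfold gF
    have : Measurable (starRingEnd ℂ : ℂ → ℂ) := Complex.continuous_conj.measurable
    fun_prop
  have hm : AEStronglyMeasurable (fun x => (gF p (u x) * (starRingEnd ℂ) (v x)).re) μ :=
    (hmeas.comp_aemeasurable ((Lp.aestronglyMeasurable u).aemeasurable.prodMk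
      (Lp.aestronglyMeasurable v).aemeasurable)).aestronglyMeasurable
  obtain ⟨hi, hle⟩ := intBound1 hp u u v
  have hb : ∀ x, ‖(gF p (u x) * (starRingEnd ℂ) (v x)).re‖ ≤
      p * (‖u x‖ ^ (p - 2) * ‖u x‖ * ‖v x‖) := fun x => by
    rw [Real.norm_eq_abs]
    refine (abs_re_mul_conj_le _ _).trans (le_of_eq ?_)
    rw [norm_gF hp]; ring
  refine ⟨(hi.const_mul p).mono' hm (Filter.Eventually.of_forall hb), ?_⟩
  have := norm_integral_le_of_norm_le (hi.const_mul p) (Filter.Eventually.of_forall hb)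
  rw [integral_const_mul, Real.norm_eq_abs] at this
  refine this.trans ?_
  rw [mul_assoc]
  exact mul_le_mul_of_nonneg_left hle (by linarith)

lemma intH (hp : 3 ≤ p) (u h v : Lp ℂ (ENNReal.ofReal p) μ) :
    Integrable (fun x => (HF p (u x) (h x) * (starRingEnd ℂ) (v x)).re) μ ∧
    |∫ x, (HF p (u x) (h x) * (starRingEnd ℂ) (v x)).re ∂μ| ≤
      p * (p - 1) * ‖u‖ ^ (p - 2) * ‖h‖ * ‖v‖ := by
  have hmeas : Measurable (fun q : ℂ × ℂ × ℂ =>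
      (HF p q.1 q.2.1 * (starRingEnd ℂ) q.2.2).re) := by
    unfold HF
    have : Measurable (starRingEnd ℂ : ℂ → ℂ) := Complex.continuous_conj.measurable
    fun_prop
  have hm : AEStronglyMeasurable
      (fun x => (HF p (u x) (h x) * (starRingEnd ℂ) (v x)).re) μ :=
    (hmeas.comp_aemeasurable ((Lp.aestronglyMeasurable u).aemeasurable.prodMk
      ((Lp.aestronglyMeasurable h).aemeasurable.prodMk
      (Lp.aestronglyMeasurable v).aemeasurable))).aestronglyMeasurable
  obtain ⟨hi, hle⟩ := intBound1 hp u h v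
  have hb : ∀ x, ‖(HF p (u x) (h x) * (starRingEnd ℂ) (v x)).re‖ ≤
      p * (p - 1) * (‖u x‖ ^ (p - 2) * ‖h x‖ * ‖v x‖) := fun x => by
    rw [Real.norm_eq_abs]
    refine (abs_re_mul_conj_le _ _).trans ?_
    refine (mul_le_mul_of_nonneg_right (norm_HF hp _ _) (norm_nonneg _)).trans (le_of_eq ?_)
    ring
  refine ⟨(hi.const_mul _).mono' hm (Filter.Eventually.of_forall hb), ?_⟩
  have := norm_integral_le_of_norm_le (hi.const_mul (p * (p - 1))) (Filter.Eventually.of_forall hb)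
  rw [integral_const_mul, Real.norm_eq_abs] at this
  refine this.trans ?_
  refine (mul_le_mul_of_nonneg_left hle (mul_nonneg (by linarith) (by linarith))).trans
    (le_of_eq ?_)
  ring

lemma exists_G (hp : 3 ≤ p) [Fact (1 ≤ ENNReal.ofReal p)] (u : Lp ℂ (ENNReal.ofReal p) μ) :
    ∃ L : Lp ℂ (ENNReal.ofReal p) μ →L[ℝ] ℝ,
      ∀ v, L v = ∫ x, (gF p (u x) * (starRingEnd ℂ) (v x)).re ∂μ := by
  refine ⟨LinearMap.mkContinuous
    { toFun := fun v => ∫ x, (gF p (u x) * (starRingEnd ℂ) (v x)).re ∂μ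
      map_add' := ?_
      map_smul' := ?_ } (p * (‖u‖ ^ (p - 2) * ‖u‖)) ?_, fun v => rfl⟩
  · intro v w
    rw [← integral_add (intG hp u v).1 (intG hp u w).1]
    refine integral_congr_ae ?_
    filter_upwards [Lp.coeFn_add v w] with x hx
    rw [hx, Pi.add_apply, map_add, mul_add, Complex.add_re]
  · intro c v
    rw [RingHom.id_apply, smul_eq_mul, ← integral_const_mul]
    refine integral_congr_ae ?_
    filter_upwards [Lp.coeFn_smul c v] with x hx
    rw [hx, Pi.smul_apply, Complex.real_smul, map_mul, Complex.conj_ofReal, mul_left_comm,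
      Complex.re_ofReal_mul]
  · intro v
    exact (intG hp u v).2

lemma exists_B (hp : 3 ≤ p) [Fact (1 ≤ ENNReal.ofReal p)] (u : Lp ℂ (ENNReal.ofReal p) μ) :
    ∃ L : Lp ℂ (ENNReal.ofReal p) μ →L[ℝ] Lp ℂ (ENNReal.ofReal p) μ →L[ℝ] ℝ,
      ∀ h v, L h v = ∫ x, (HF p (u x) (h x) * (starRingEnd ℂ) (v x)).re ∂μ := by
  refine ⟨LinearMap.mkContinuous₂ (LinearMap.mk₂ ℝ
    (fun h v => ∫ x, (HF p (u x) (h x) * (starRingEnd ℂ) (v x)).re ∂μ) ?_ ?_ ?_ ?_)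
    (p * (p - 1) * ‖u‖ ^ (p - 2)) ?_, fun h v => rfl⟩
  · intro h k v
    rw [← integral_add (intH hp u h v).1 (intH hp u k v).1]
    refine integral_congr_ae ?_
    filter_upwards [Lp.coeFn_add h k] with x hx
    rw [hx, Pi.add_apply, HF_add, add_mul, Complex.add_re]
  · intro c h v
    rw [smul_eq_mul, ← integral_const_mul]
    refine integral_congr_ae ?_
    filter_upwards [Lp.coeFn_smul c h] with x hx
    rw [hx, Pi.smul_apply, HF_smul, Complex.real_smul, mul_assoc, Complex.re_ofReal_mul]
  · intro h v w
    rw [← integral_add (intH hp u h v).1 (intH hp u h w).1]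
    refine integral_congr_ae ?_
    filter_upwards [Lp.coeFn_add v w] with x hx
    rw [hx, Pi.add_apply, map_add, mul_add, Complex.add_re]
  · intro c h v
    rw [smul_eq_mul, ← integral_const_mul]
    refine integral_congr_ae ?_
    filter_upwards [Lp.coeFn_smul c v] with x hx
    rw [hx, Pi.smul_apply, Complex.real_smul, map_mul, Complex.conj_ofReal, mul_left_comm,
      Complex.re_ofReal_mul]
  · intro h v
    exact (intH hp u h v).2

lemma main_aux (hp : 3 ≤ p) [Fact (1 ≤ ENNReal.ofReal p)] :
    ∃ (G : Lp ℂ (ENNReal.ofReal p) μ → Lp ℂ (ENNReal.ofReal p) μ →L[ℝ] ℝ),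
      (∀ u v, G u v = ∫ x, (gF p (u x) * (starRingEnd ℂ) (v x)).re ∂μ) ∧
      (∀ u, HasFDerivAt (fun u : Lp ℂ (ENNReal.ofReal p) μ => ∫ x, ‖u x‖ ^ p ∂μ) (G u) u) ∧
      Differentiable ℝ G := by
  choose G hG using exists_G (μ := μ) hp
  choose B hB using exists_B (μ := μ) hp
  refine ⟨G, hG, fun u => ?_, fun u => ?_⟩
  · obtain ⟨C, hC, hb⟩ := bound_f hp
    refine hasFDerivAt_of_quad (C := C) (r := p - 2) hC (by linarith) fun h => ?_
    rw [hG, integral_sub_sub (intBound0 hp _) (intBound0 hp _) (intG hp u h).1]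
    obtain ⟨hi, hle⟩ := intBound3 hp u h
    refine (norm_integral_le_of_norm_le (hi.const_mul C) ?_).trans ?_
    · filter_upwards [Lp.coeFn_add u h] with x hx
      rw [hx, Pi.add_apply, Real.norm_eq_abs]
      exact hb (u x) (h x)
    · rw [integral_const_mul]
      exact mul_le_mul_of_nonneg_left hle hC
  · obtain ⟨C, hC, hb⟩ := bound_gF hp
    refine (hasFDerivAt_of_quad (f' := B u) (C := C) (r := p - 3) hC (by linarith)
      fun h => ?_).differentiableAt
    refine ContinuousLinearMap.opNorm_le_bound _ (by positivity) fun v => ?_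
    simp only [_root_.sub_apply]
    rw [hG, hG, hB, integral_sub_sub (intG hp _ _).1 (intG hp _ _).1 (intH hp _ _ _).1]
    obtain ⟨hi, hle⟩ := intBound2 hp u h v
    refine (norm_integral_le_of_norm_le (hi.const_mul C) ?_).trans ?_
    · filter_upwards [Lp.coeFn_add u h] with x hx
      rw [hx, Pi.add_apply, Real.norm_eq_abs, ← Complex.sub_re, ← Complex.sub_re, ← sub_mul,
        ← sub_mul]
      refine (abs_re_mul_conj_le _ _).trans ?_
      refine (mul_le_mul_of_nonneg_right (hb (u x) (h x)) (norm_nonneg _)).trans (le_of_eq ?_)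
      ring
    · rw [integral_const_mul, mul_assoc C]
      exact mul_le_mul_of_nonneg_left hle hC

end LpPart

/-- The functional `Φ(u) = ∫ |u|^{2σ}` on `L^{2σ}(M;ℂ)`, `σ ≥ 3/2`, is twice (real)
Fréchet differentiable with `Φ'(u)(v) = ∫ 2σ |u|^{2(σ-1)} Re(u conj(v))`. -/
theorem power_functional_twice_differentiable
    {M : Type*} [MeasurableSpace M] (μ : Measure M) [IsFiniteMeasure μ]
    (σ : ℝ) (hσ : 3 / 2 ≤ σ) [Fact (1 ≤ ENNReal.ofReal (2 * σ))] :
    Differentiable ℝ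
        (fun u : Lp ℂ (ENNReal.ofReal (2 * σ)) μ => ∫ x, ‖u x‖ ^ (2 * σ) ∂μ) ∧
    Differentiable ℝ
        (fderiv ℝ (fun u : Lp ℂ (ENNReal.ofReal (2 * σ)) μ =>
          ∫ x, ‖u x‖ ^ (2 * σ) ∂μ)) ∧
    ∀ u v : Lp ℂ (ENNReal.ofReal (2 * σ)) μ,
      fderiv ℝ (fun w : Lp ℂ (ENNReal.ofReal (2 * σ)) μ =>
          ∫ x, ‖w x‖ ^ (2 * σ) ∂μ) u v
        = ∫ x, 2 * σ * ‖u x‖ ^ (2 * (σ - 1)) * (u x * (starRingEnd ℂ) (v x)).re ∂μ := by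
  obtain ⟨G, hG, hd, hdd⟩ := main_aux (μ := μ) (p := 2 * σ) (by linarith)
  have hf : fderiv ℝ (fun u : Lp ℂ (ENNReal.ofReal (2 * σ)) μ => ∫ x, ‖u x‖ ^ (2 * σ) ∂μ) = G :=
    funext fun u => (hd u).fderiv
  refine ⟨fun u => (hd u).differentiableAt, by rw [hf]; exact hdd, fun u v => ?_⟩
  rw [hf, hG]
  refine integral_congr_ae (Filter.Eventually.of_forall fun x => ?_)
  simp only [gF, Complex.real_smul]
  rw [mul_assoc, Complex.re_ofReal_mul, show 2 * σ - 2 = 2 * (σ - 1) by ring]
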